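/- Let ℓ : ℕ and let T, T' : ℕ satisfy T ≤ T' and T' < 2^ℓ. Then for every bitstring v' ∈ CTNodes(ℓ, T') there exists a bitstring v ∈ CTNodes(ℓ, T) such that v is a prefix of v'. (This is the delegation property of CTNodes that makes ciphertext update from time T to any later time T' possible.) -/

import Mathlib

/-- The leaf of the depth-`ℓ` complete binary tree assigned to time `T`:
the big-endian `ℓ`-bit binary representation of `T`. -/
def leaf (ℓ T : ℕ) : List Bool :=
  (List.range ℓ).map (fun i => T.testBit (ℓ - 1 - i))

/-- `PathSet v` is the set of prefixes of `v` (from the root to `v`). -/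
def PathSet (v : List Bool) : Set (List Bool) :=
  {p | p <+: v}

/-- `Parent v` is `v` with its last bit removed. -/
def Parent (v : List Bool) : List Bool :=
  v.dropLast

/-- `RightSibling S = { Parent v ++ [true] : v ∈ S, v ≠ [] }`. -/
def RightSibling (S : Set (List Bool)) : Set (List Bool) :=
  {w | ∃ v ∈ S, v ≠ [] ∧ w = Parent v ++ [true]}

/-- Wei et al.'s (corrected) `CTNodes` set:
`(RightSibling(PathSet(v_T)) \ PathSet(Parent(v_T))) ∪ {v_T}`. -/
def CTNodes (ℓ T : ℕ) : Set (List Bool) :=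
  (RightSibling (PathSet (leaf ℓ T)) \ PathSet (Parent (leaf ℓ T))) ∪ {leaf ℓ T}

theorem leaf_succ (ℓ T : ℕ) : leaf (ℓ + 1) T = T.testBit ℓ :: leaf ℓ T := by
  simp only [leaf, List.range_succ_eq_map, List.map_cons, List.map_map, Nat.add_sub_cancel,
    Nat.sub_zero]
  congr 1
  refine List.map_congr_left fun i _ => ?_
  simp only [Function.comp_apply]
  congr 1
  omega

/-- Two leaves in strict left-to-right order branch off at a common ancestor. -/
theorem exists_branching_prefix (ℓ T T' : ℕ) (h : T % 2 ^ ℓ < T' % 2 ^ ℓ) :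
    ∃ u, u ++ [false] <+: leaf ℓ T ∧ u ++ [true] <+: leaf ℓ T' := by
  induction ℓ with
  | zero => simp [Nat.mod_one] at h
  | succ ℓ ih =>
    have hT := Nat.mod_lt T (Nat.two_pow_pos ℓ)
    have hT' := Nat.mod_lt T' (Nat.two_pow_pos ℓ)
    rw [Nat.mod_pow_succ, Nat.mod_pow_succ, ← Nat.toNat_testBit, ← Nat.toNat_testBit] at h
    simp only [leaf_succ]
    have extend (b : Bool) (hlt : T % 2 ^ ℓ < T' % 2 ^ ℓ) :
        ∃ u, u ++ [false] <+: b :: leaf ℓ T ∧ u ++ [true] <+: b :: leaf ℓ T' := by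
      obtain ⟨u, hu, hu'⟩ := ih hlt
      exact ⟨b :: u, by simpa using hu, by simpa using hu'⟩
    cases hb : T.testBit ℓ <;> cases hb' : T'.testBit ℓ <;> simp [hb, hb'] at h
    · exact extend false h
    · exact ⟨[], by simp, by simp⟩
    · omega
    · exact extend true h

theorem append_true_mem_CTNodes {ℓ T : ℕ} {u : List Bool} (h : u ++ [false] <+: leaf ℓ T) :
    u ++ [true] ∈ CTNodes ℓ T := by
  refine Or.inl ⟨⟨u ++ [false], h, by simp, by simp [Parent]⟩, fun hu => ?_⟩
  have hu' : u ++ [true] <+: leaf ℓ T := hu.trans (List.dropLast_prefix _)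
  have := (List.prefix_of_prefix_length_le h hu' (by simp)).eq_of_length (by simp)
  simp at this

theorem eq_leaf_or_exists_of_mem_CTNodes {ℓ T : ℕ} {w : List Bool} (h : w ∈ CTNodes ℓ T) :
    w = leaf ℓ T ∨ ∃ u, u ++ [false] <+: leaf ℓ T ∧ w = u ++ [true] := by
  rcases h with ⟨⟨p, hp, hne, rfl⟩, hw⟩ | h
  · obtain ⟨u, b, rfl⟩ := List.eq_nil_or_concat' p |>.resolve_left hne
    have hp' : u ++ [b] <+: leaf ℓ T := hp
    cases b with
    | false => exact Or.inr ⟨u, hp', by simp [Parent]⟩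
    | true =>
      left
      simp only [Parent, List.dropLast_concat, PathSet, Set.mem_ofPred_eq] at hw ⊢
      by_contra hne'
      rcases List.eq_nil_or_concat' (leaf ℓ T) with h0 | ⟨v, c, hv⟩
      · simp [h0] at hp'
      · rw [hv] at hp' hw hne'
        rw [List.dropLast_concat] at hw
        exact (List.prefix_concat_iff.1 hp').elim hne' hw
  · exact Or.inl h

/-- Delegation property: if `T ≤ T' < 2^ℓ`, then every node of
`CTNodes(ℓ, T')` has a prefix in `CTNodes(ℓ, T)`. -/
theorem ctnodes_delegation (ℓ T T' : ℕ)
    (hTT' : T ≤ T') (hT' : T' < 2 ^ ℓ) :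
    ∀ v' ∈ CTNodes ℓ T', ∃ v ∈ CTNodes ℓ T, v <+: v' := by
  intro v' hv'
  rcases hTT'.eq_or_lt with rfl | hlt
  · exact ⟨v', hv', List.prefix_rfl⟩
  obtain ⟨u, hu, hu'⟩ := exists_branching_prefix ℓ T T' (by
    rwa [Nat.mod_eq_of_lt (hlt.trans hT'), Nat.mod_eq_of_lt hT'])
  rcases eq_leaf_or_exists_of_mem_CTNodes hv' with rfl | ⟨s, hs, rfl⟩
  · exact ⟨_, append_true_mem_CTNodes hu, hu'⟩
  rcases List.prefix_or_prefix_of_prefix hu' hs with h | h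
  · rcases List.prefix_concat_iff.1 h with h | h
    · simp at h
    · exact ⟨_, append_true_mem_CTNodes hu, h.trans (List.prefix_append _ _)⟩
  · rcases List.prefix_concat_iff.1 h with h | h
    · simp at h
    · exact ⟨_, append_true_mem_CTNodes (h.trans ((List.prefix_append _ _).trans hu)),
        List.prefix_rfl⟩
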